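/- Let n ≥ 1, p > 0, ε > 0, α > 0 and 0 < R < R₁. Let S ⊂ ℝ be the set of s such that ρ^{2−2n}(s − G(ρ))² ≤ α² for all ρ ∈ [R, R₁], and for s ∈ S define M(s) = ∫_R^{R₁} (s − G(ρ)) / (ρ^{n−1} E_ε^{-1}(ρ^{2−2n}(s − G(ρ))²)) dρ, where G(ρ) = ρ^{n+p}/(n+p). Then M is strictly increasing on S; in particular M has at most one zero in S. -/

import Mathlib

/-- `E_ε(x) = x²(α² + 2ε ln x)`. -/
noncomputable def Eeps (α ε : ℝ) (x : ℝ) : ℝ := x ^ 2 * (α ^ 2 + 2 * ε * Real.log x)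

/-- `E_ε⁻¹ : [0, α²] → [exp(−α²/(2ε)), 1]`, the inverse of the strictly
increasing bijection `E_ε` from `[exp(−α²/(2ε)), 1]` onto `[0, α²]`. -/
noncomputable def EepsInv (α ε : ℝ) (t : ℝ) : ℝ :=
  Function.invFunOn (Eeps α ε) (Set.Icc (Real.exp (-α ^ 2 / (2 * ε))) 1) t

/-- The map `y ↦ y exp((y² − α²)/(2ε))`, whose inverse is `w ↦ w / E_ε⁻¹(w²)` on `[−α, α]`. -/
noncomputable def mulExpSq (α ε : ℝ) (y : ℝ) : ℝ := y * Real.exp ((y ^ 2 - α ^ 2) / (2 * ε))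

theorem continuous_mulExpSq (α ε : ℝ) : Continuous (mulExpSq α ε) := by
  unfold mulExpSq
  fun_prop

theorem strictMono_mulExpSq (α : ℝ) {ε : ℝ} (hε : 0 < ε) : StrictMono (mulExpSq α ε) := by
  refine strictMono_of_hasDerivAt_pos
    (f' := fun y => Real.exp ((y ^ 2 - α ^ 2) / (2 * ε)) * (1 + y ^ 2 / ε)) (fun y => ?_)
    (fun y => by positivity)
  have h := (hasDerivAt_id y).mul
    ((((hasDerivAt_pow 2 y).sub_const (α ^ 2)).div_const (2 * ε)).exp)
  refine h.congr_deriv ?_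
  simp only [id]
  field_simp
  push_cast
  ring

theorem surjective_mulExpSq (α : ℝ) {ε : ℝ} (hε : 0 < ε) :
    Function.Surjective (mulExpSq α ε) := by
  have hc : 0 < Real.exp (-α ^ 2 / (2 * ε)) := Real.exp_pos _
  have hle (y : ℝ) : Real.exp (-α ^ 2 / (2 * ε)) ≤ Real.exp ((y ^ 2 - α ^ 2) / (2 * ε)) := by
    gcongr
    linarith [sq_nonneg y]
  refine (continuous_mulExpSq α ε).surjective ?_ ?_
  · refine Filter.tendsto_atTop_mono' _ ?_ (Filter.tendsto_id.atTop_mul_const hc)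
    filter_upwards [Filter.eventually_ge_atTop 0] with y hy
    exact mul_le_mul_of_nonneg_left (hle y) hy
  · refine Filter.tendsto_atBot_mono' _ ?_ (Filter.tendsto_id.atBot_mul_const hc)
    filter_upwards [Filter.eventually_le_atBot 0] with y hy
    exact mul_le_mul_of_nonpos_left (hle y) hy

theorem surjOn_Eeps (α : ℝ) {ε : ℝ} (hε : 0 < ε) :
    Set.SurjOn (Eeps α ε) (Set.Icc (Real.exp (-α ^ 2 / (2 * ε))) 1) (Set.Icc 0 (α ^ 2)) := by
  have hle : Real.exp (-α ^ 2 / (2 * ε)) ≤ 1 :=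
    Real.exp_le_one_iff.2 (div_nonpos_of_nonpos_of_nonneg (by nlinarith [sq_nonneg α])
      (by positivity))
  have hcont : ContinuousOn (Eeps α ε) (Set.Icc (Real.exp (-α ^ 2 / (2 * ε))) 1) := by
    unfold Eeps
    refine (continuousOn_id.pow 2).mul (continuousOn_const.add (continuousOn_const.mul
      (Real.continuousOn_log.mono fun x hx => ?_)))
    exact ((Real.exp_pos _).trans_le hx.1).ne'
  have h := intermediate_value_Icc hle hcont
  have h0 : Eeps α ε (Real.exp (-α ^ 2 / (2 * ε))) = 0 := by
    rw [Eeps, Real.log_exp]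
    field_simp
    ring
  have h1 : Eeps α ε 1 = α ^ 2 := by simp [Eeps]
  rwa [h0, h1] at h

theorem mulExpSq_div_EepsInv {α ε w : ℝ} (hε : 0 < ε) (hw : w ^ 2 ≤ α ^ 2) :
    mulExpSq α ε (w / EepsInv α ε (w ^ 2)) = w := by
  have hmem : w ^ 2 ∈ Eeps α ε '' Set.Icc (Real.exp (-α ^ 2 / (2 * ε))) 1 :=
    surjOn_Eeps α hε ⟨sq_nonneg w, hw⟩
  have hpos : 0 < EepsInv α ε (w ^ 2) :=
    (Real.exp_pos _).trans_le (Function.invFunOn_mem hmem).1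
  have heq : Eeps α ε (EepsInv α ε (w ^ 2)) = w ^ 2 := Function.invFunOn_eq hmem
  generalize EepsInv α ε (w ^ 2) = x at hpos heq
  have hlog : ((w / x) ^ 2 - α ^ 2) / (2 * ε) = Real.log x := by
    rw [div_pow, ← heq, Eeps]
    field_simp
    ring
  rw [mulExpSq, hlog, Real.exp_log hpos]
  field_simp

/-- The function
`M(s) = ∫_R^{R₁} (s − G(ρ)) / (ρ^{n−1} E_ε⁻¹(ρ^{2−2n}(s − G(ρ))²)) dρ`,
with `G(ρ) = ρ^{n+p}/(n+p)`, is strictly increasing on the set of `s` for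
which `ρ^{2−2n}(s − G(ρ))² ≤ α²` on all of `[R, R₁]`; in particular it has
at most one zero there. -/
theorem stmt_15 (n : ℕ) (hn : 1 ≤ n) (p ε α R R₁ : ℝ)
    (hp : 0 < p) (hε : 0 < ε) (hα : 0 < α) (hR : 0 < R) (hRR₁ : R < R₁) :
    StrictMonoOn
      (fun s : ℝ => ∫ ρ in R..R₁,
        (s - ρ ^ ((n : ℝ) + p) / ((n : ℝ) + p)) /
          (ρ ^ ((n : ℝ) - 1) *
            EepsInv α ε (ρ ^ ((2 : ℝ) - 2 * n) *
              (s - ρ ^ ((n : ℝ) + p) / ((n : ℝ) + p)) ^ 2)))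
      {s : ℝ | ∀ ρ ∈ Set.Icc R R₁,
        ρ ^ ((2 : ℝ) - 2 * n) *
          (s - ρ ^ ((n : ℝ) + p) / ((n : ℝ) + p)) ^ 2 ≤ α ^ 2} := by
  let k := (strictMono_mulExpSq α hε).orderIsoOfSurjective _ (surjective_mulExpSq α hε)
  let w (s ρ : ℝ) : ℝ := (s - ρ ^ ((n : ℝ) + p) / ((n : ℝ) + p)) / ρ ^ ((n : ℝ) - 1)
  have hw_sq (s : ℝ) {ρ : ℝ} (hρ : 0 < ρ) : ρ ^ ((2 : ℝ) - 2 * n) *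
      (s - ρ ^ ((n : ℝ) + p) / ((n : ℝ) + p)) ^ 2 = w s ρ ^ 2 := by
    have hpow : ρ ^ ((2 : ℝ) - 2 * n) = ((ρ ^ ((n : ℝ) - 1)) ^ 2)⁻¹ := by
      rw [← Real.rpow_mul_natCast hρ.le, ← Real.rpow_neg hρ.le]
      congr 1
      push_cast
      ring
    rw [hpow, div_pow]
    exact (div_eq_inv_mul _ _).symm
  have hintegrand {s ρ : ℝ} (hρ : 0 < ρ) (h : ρ ^ ((2 : ℝ) - 2 * n) *
      (s - ρ ^ ((n : ℝ) + p) / ((n : ℝ) + p)) ^ 2 ≤ α ^ 2) :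
      (s - ρ ^ ((n : ℝ) + p) / ((n : ℝ) + p)) / (ρ ^ ((n : ℝ) - 1) *
        EepsInv α ε (ρ ^ ((2 : ℝ) - 2 * n) *
          (s - ρ ^ ((n : ℝ) + p) / ((n : ℝ) + p)) ^ 2)) = k.symm (w s ρ) := by
    rw [hw_sq s hρ] at h ⊢
    rw [← div_div, eq_comm, k.symm_apply_eq]
    exact (mulExpSq_div_EepsInv hε h).symm
  have hcont (s : ℝ) : ContinuousOn (fun ρ => k.symm (w s ρ)) (Set.Icc R R₁) := by
    have hpow (a : ℝ) : ContinuousOn (fun ρ : ℝ => ρ ^ a) (Set.Icc R R₁) :=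
      continuousOn_id.rpow_const fun ρ hρ => Or.inl (hR.trans_le hρ.1).ne'
    exact k.symm.continuous.comp_continuousOn
      ((continuousOn_const.sub ((hpow _).div_const _)).div (hpow _)
        fun ρ hρ => (Real.rpow_pos_of_pos (hR.trans_le hρ.1) _).ne')
  have hlt {s t ρ : ℝ} (hst : s < t) (hρ : 0 < ρ) : k.symm (w s ρ) < k.symm (w t ρ) :=
    k.symm.strictMono (div_lt_div_of_pos_right (sub_lt_sub_right hst _)
      (Real.rpow_pos_of_pos hρ _))
  have hintegral {s : ℝ} (hs : ∀ ρ ∈ Set.Icc R R₁, ρ ^ ((2 : ℝ) - 2 * n) *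
      (s - ρ ^ ((n : ℝ) + p) / ((n : ℝ) + p)) ^ 2 ≤ α ^ 2) :
      (∫ ρ in R..R₁, (s - ρ ^ ((n : ℝ) + p) / ((n : ℝ) + p)) / (ρ ^ ((n : ℝ) - 1) *
        EepsInv α ε (ρ ^ ((2 : ℝ) - 2 * n) *
          (s - ρ ^ ((n : ℝ) + p) / ((n : ℝ) + p)) ^ 2))) =
        ∫ ρ in R..R₁, k.symm (w s ρ) :=
    intervalIntegral.integral_congr fun ρ hρ => by
      rw [Set.uIcc_of_le hRR₁.le] at hρ
      exact hintegrand (hR.trans_le hρ.1) (hs ρ hρ)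
  intro s hs t ht hst
  dsimp only
  rw [hintegral hs, hintegral ht]
  exact intervalIntegral.integral_lt_integral_of_continuousOn_of_le_of_exists_lt hRR₁
    (hcont s) (hcont t) (fun ρ hρ => (hlt hst (hR.trans hρ.1)).le)
    ⟨R, Set.left_mem_Icc.2 hRR₁.le, hlt hst hR⟩
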